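/- Let n ≥ 1 and m ≥ 0 be coprime integers and (a, b) ∈ ℝ × ℝ, and suppose the line {(a + t*n, b + t*m) : t ∈ ℝ} contains no knot (no point with both coordinates in {k/2 : k ∈ ℤ}). Then the set of parameters t ∈ [0, 1) for which a + t*n ∈ {k/2 : k ∈ ℤ}, or b + t*m ∈ {k/2 : k ∈ ℤ}, or (a + b) + t*(n + m) ∈ {k/2 : k ∈ ℤ}, is finite and has exactly 4*(n + m) elements. (Hence the geodesic of type (n, m) on the disphenoid has exactly 4(n+m) nodes on the edges.) -/

import Mathlib

/-- A real number is a half-integer if it equals `k/2` for some integer `k`. -/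
def IsHalfInt (x : ℝ) : Prop := ∃ k : ℤ, x = k / 2

/-- A point of `ℝ²` is a knot of the full net of the disphenoid if both of its
coordinates are half-integers. -/
def IsKnot (p : ℝ × ℝ) : Prop := IsHalfInt p.1 ∧ IsHalfInt p.2

theorem IsHalfInt.sub {x y : ℝ} (hx : IsHalfInt x) (hy : IsHalfInt y) : IsHalfInt (x - y) := by
  obtain ⟨k, rfl⟩ := hx
  obtain ⟨l, rfl⟩ := hy
  exact ⟨k - l, by push_cast; ring⟩

/-- An affine function of positive integer slope `n` takes half-integer values on `[0, 1)` exactly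
at the preimages of the half-integers `k / 2` with `⌈2c⌉ ≤ k < ⌈2c⌉ + 2n`. -/
theorem setOf_isHalfInt_eq_image {n : ℤ} (hn : 1 ≤ n) (c : ℝ) :
    {t : ℝ | t ∈ Set.Ico (0 : ℝ) 1 ∧ IsHalfInt (c + t * n)} =
      (fun k : ℤ ↦ ((k : ℝ) / 2 - c) / n) '' (Finset.Ico ⌈2 * c⌉ (⌈2 * c⌉ + 2 * n) : Set ℤ) := by
  have hn0 : (0 : ℝ) < n := by exact_mod_cast hn
  have hceil : ⌈2 * c⌉ + 2 * n = ⌈2 * c + 2 * n⌉ := by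
    rw [← Int.ceil_add_intCast]
    push_cast
    rfl
  ext t
  simp only [Set.mem_ofPred_eq, Set.mem_Ico, Set.mem_image, Finset.coe_Ico, hceil, Int.ceil_le,
    Int.lt_ceil]
  constructor
  · rintro ⟨⟨h0, h1⟩, k, hk⟩
    refine ⟨k, ⟨by nlinarith, by nlinarith⟩, ?_⟩
    rw [← hk]
    field_simp
    ring
  · rintro ⟨k, ⟨h0, h1⟩, rfl⟩
    refine ⟨⟨div_nonneg (by linarith) hn0.le, (div_lt_one hn0).2 (by linarith)⟩, k, ?_⟩
    field_simp
    ring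

theorem finite_setOf_isHalfInt {n : ℤ} (hn : 1 ≤ n) (c : ℝ) :
    {t : ℝ | t ∈ Set.Ico (0 : ℝ) 1 ∧ IsHalfInt (c + t * n)}.Finite := by
  rw [setOf_isHalfInt_eq_image hn]
  exact (Finset.finite_toSet _).image _

theorem ncard_setOf_isHalfInt {n : ℤ} (hn : 1 ≤ n) (c : ℝ) :
    ({t : ℝ | t ∈ Set.Ico (0 : ℝ) 1 ∧ IsHalfInt (c + t * n)}.ncard : ℤ) = 2 * n := by
  have hn0 : (n : ℝ) ≠ 0 := by exact_mod_cast (by lia : n ≠ 0)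
  rw [setOf_isHalfInt_eq_image hn, Set.ncard_image_of_injective, Set.ncard_coe_finset,
    Int.card_Ico]
  · lia
  · intro k l hkl
    have h : (k : ℝ) / 2 - c = l / 2 - c := (div_left_inj' hn0).1 hkl
    exact_mod_cast (by linarith : (k : ℝ) = l)


/-- A knot-free line of direction `(n, m)` (with `n ≥ 1`, `m ≥ 0` coprime)
crosses the edge lines `x ∈ (1/2)ℤ`, `y ∈ (1/2)ℤ`, `x + y ∈ (1/2)ℤ` of the net
at exactly `4(n+m)` parameters in `[0, 1)`; hence the geodesic of type `(n, m)`
on the disphenoid has exactly `4(n+m)` nodes. -/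
theorem geodesic_has_4nm_nodes
    (n m : ℤ) (hn : 1 ≤ n) (hm : 0 ≤ m) (hco : IsCoprime n m) (a b : ℝ)
    (hline : ∀ t : ℝ, ¬ (IsHalfInt (a + t * n) ∧ IsHalfInt (b + t * m))) :
    {t : ℝ | t ∈ Set.Ico (0 : ℝ) 1 ∧
      (IsHalfInt (a + t * n) ∨ IsHalfInt (b + t * m) ∨
        IsHalfInt ((a + b) + t * (n + m)))}.Finite ∧
    ({t : ℝ | t ∈ Set.Ico (0 : ℝ) 1 ∧
      (IsHalfInt (a + t * n) ∨ IsHalfInt (b + t * m) ∨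
        IsHalfInt ((a + b) + t * (n + m)))}.ncard : ℤ) = 4 * (n + m) := by
  set A := {t : ℝ | t ∈ Set.Ico (0 : ℝ) 1 ∧ IsHalfInt (a + t * n)} with hA
  set B := {t : ℝ | t ∈ Set.Ico (0 : ℝ) 1 ∧ IsHalfInt (b + t * m)} with hB
  set C := {t : ℝ | t ∈ Set.Ico (0 : ℝ) 1 ∧ IsHalfInt ((a + b) + t * (n + m))} with hC
  have hunion : {t : ℝ | t ∈ Set.Ico (0 : ℝ) 1 ∧
      (IsHalfInt (a + t * n) ∨ IsHalfInt (b + t * m) ∨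
        IsHalfInt ((a + b) + t * (n + m)))} = A ∪ (B ∪ C) := by
    ext t
    simp only [hA, hB, hC, Set.mem_union, Set.mem_ofPred_eq]
    tauto
  have hAfin : A.Finite := finite_setOf_isHalfInt hn a
  have hAcard : (A.ncard : ℤ) = 2 * n := ncard_setOf_isHalfInt hn a
  have hCfin : C.Finite := by
    simpa [hC] using finite_setOf_isHalfInt (by lia : 1 ≤ n + m) (a + b)
  have hCcard : (C.ncard : ℤ) = 2 * (n + m) := by
    simpa [hC] using ncard_setOf_isHalfInt (by lia : 1 ≤ n + m) (a + b)
  have hBoth : B.Finite ∧ (B.ncard : ℤ) = 2 * m := by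
    rcases hm.eq_or_lt with rfl | hm
    · have hn0 : (n : ℝ) ≠ 0 := by exact_mod_cast (by lia : n ≠ 0)
      have hBempty : B = ∅ := by
        refine Set.eq_empty_of_forall_notMem fun t ht ↦ hline (-a / n) ⟨⟨0, ?_⟩, ?_⟩
        · field_simp
          simp
        · simpa using ht.2
      simp [hBempty]
    · exact ⟨finite_setOf_isHalfInt hm b, ncard_setOf_isHalfInt hm b⟩
  obtain ⟨hBfin, hBcard⟩ := hBoth
  have hBC : Disjoint B C := by
    refine Set.disjoint_left.2 fun t hb hc ↦ hline t ⟨?_, hb.2⟩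
    convert hc.2.sub hb.2 using 1
    ring
  have hABC : Disjoint A (B ∪ C) := by
    refine Set.disjoint_left.2 fun t ha hbc ↦ hline t ⟨ha.2, ?_⟩
    rcases hbc with hb | hc
    · exact hb.2
    · convert hc.2.sub ha.2 using 1
      ring
  rw [hunion]
  refine ⟨hAfin.union (hBfin.union hCfin), ?_⟩
  rw [Set.ncard_union_eq hABC hAfin (hBfin.union hCfin), Set.ncard_union_eq hBC hBfin hCfin]
  push_cast
  linarith
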